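/- arXiv:2004.06530 — 5 statements merged into one kernel-verified Lean document; each statement's English description precedes it below -/
import Mathlib

section
/- Let f and g be pipeline instances with Fail f, not Fail g, and f and g disjoint (the Disjointness Condition). Suppose that every minimal definitive root cause (S, c) has S a singleton set. Then, for any list enumerating every parameter of P exactly once, the asserted root cause (D, f) of the Shortcut run on f and g is itself a minimal definitive root cause (in particular, D is a singleton {p} and ({p}, f) is a definitive root cause). -/
open scoped Classical

/-- One step of the Shortcut algorithm: try replacing the value of `cur` at `p`
by `g p`; keep the replacement exactly when the result fails. -/
noncomputable def shortcutStep {P : Type*} [DecidableEq P] {V : P → Type*}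
    (Fail : ((p : P) → V p) → Prop) (g : (p : P) → V p)
    (cur : (p : P) → V p) (p : P) : (p : P) → V p :=
  if Fail (Function.update cur p (g p)) then Function.update cur p (g p) else cur

/-- The final instance of the Shortcut run on `f` and `g`, processing the
parameters in the order given by the list `l`. -/
noncomputable def shortcutFinal {P : Type*} [DecidableEq P] {V : P → Type*}
    (Fail : ((p : P) → V p) → Prop) (f g : (p : P) → V p) (l : List P) :
    (p : P) → V p :=
  l.foldl (shortcutStep Fail g) f

/-- The parameter set of the asserted root cause: parameters where the final
instance agrees with `f`. -/
def assertedSet {P : Type*} {V : P → Type*}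
    (finalInst f : (p : P) → V p) : Set P :=
  {p : P | finalInst p = f p}

/-- An instance `x` satisfies the candidate `(S, c)` if it agrees with `c` on `S`. -/
def Satisfies {P : Type*} {V : P → Type*}
    (x : (p : P) → V p) (S : Set P) (c : (p : P) → V p) : Prop :=
  ∀ p ∈ S, x p = c p

/-- `(S, c)` is a definitive root cause: some failing instance satisfies it and
every instance satisfying it fails. -/
def DefinitiveRootCause {P : Type*} {V : P → Type*}
    (Fail : ((p : P) → V p) → Prop) (S : Set P) (c : (p : P) → V p) : Prop :=
  (∃ x, Fail x ∧ Satisfies x S c) ∧ (∀ x, Satisfies x S c → Fail x)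

/-- `(S, c)` is a minimal definitive root cause. -/
def MinimalDRC {P : Type*} {V : P → Type*}
    (Fail : ((p : P) → V p) → Prop) (S : Set P) (c : (p : P) → V p) : Prop :=
  DefinitiveRootCause Fail S c ∧ ∀ S' ⊂ S, ¬ DefinitiveRootCause Fail S' c

theorem aux_fail {P : Type*} [DecidableEq P] {V : P → Type*}
    (Fail : ((p : P) → V p) → Prop) (g : (p : P) → V p) (l : List P) :
    ∀ f : (p : P) → V p, Fail f → Fail (shortcutFinal Fail f g l) := by
  induction l with
  | nil => intro f hf; exact hf
  | cons a l ih =>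
    intro f hf
    refine ih _ ?_
    unfold shortcutStep
    split_ifs with h
    · exact h
    · exact hf

theorem aux_step {P : Type*} [DecidableEq P] {V : P → Type*}
    (Fail : ((p : P) → V p) → Prop) (g f : (p : P) → V p) (a p : P) :
    shortcutStep Fail g f a p = f p ∨ shortcutStep Fail g f a p = g p := by
  unfold shortcutStep
  split_ifs with h
  · by_cases hp : p = a
    · subst hp; right; simp
    · left; simp [hp]
  · left; rfl

theorem aux_val {P : Type*} [DecidableEq P] {V : P → Type*}
    (Fail : ((p : P) → V p) → Prop) (g : (p : P) → V p) (l : List P) (p : P) :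
    ∀ f : (p : P) → V p, shortcutFinal Fail f g l p = f p ∨
      shortcutFinal Fail f g l p = g p := by
  induction l with
  | nil => intro f; left; rfl
  | cons a l ih =>
    intro f
    have h1 := ih (shortcutStep Fail g f a)
    have h2 := aux_step Fail g f a p
    change shortcutFinal Fail (shortcutStep Fail g f a) g l p = f p ∨
      shortcutFinal Fail (shortcutStep Fail g f a) g l p = g p
    rcases h1 with h1 | h1
    · rw [h1]; exact h2
    · right; exact h1

theorem aux_other {P : Type*} [DecidableEq P] {V : P → Type*}
    (Fail : ((p : P) → V p) → Prop) (g : (p : P) → V p) (q r : P) (hr : r ≠ q)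
    (v : V q) (hv : v ≠ g q) (hF : ∀ x : (p : P) → V p, x q = v → Fail x) (l : List P) :
    ∀ f : (p : P) → V p, shortcutFinal Fail f g l q = v → r ∈ l →
      shortcutFinal Fail f g l r = g r := by
  induction l with
  | nil => intro f _ h; simp at h
  | cons a l ih =>
    intro f hq hmem
    have hfq : f q = v := by
      rcases aux_val Fail g (a :: l) q f with h | h
      · rw [← h, hq]
      · exact absurd (hq.symm.trans h) hv
    rcases List.mem_cons.1 hmem with h | h
    · subst h
      have hs : shortcutStep Fail g f r r = g r := by
        unfold shortcutStep
        rw [if_pos (hF _ (by simp [hr.symm, hfq]))]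
        simp
      rcases aux_val Fail g l r (shortcutStep Fail g f r) with h | h
      · exact h.trans hs
      · exact h
    · exact ih _ hq h

theorem aux_min {P : Type*} [Fintype P] {V : P → Type*}
    (Fail : ((p : P) → V p) → Prop) (x : (p : P) → V p) (hx : Fail x) :
    ∃ S, MinimalDRC Fail S x := by
  have h0 : DefinitiveRootCause Fail Set.univ x := by
    refine ⟨⟨x, hx, fun _ _ => rfl⟩, fun y hy => ?_⟩
    have : y = x := funext fun p => hy p trivial
    rwa [this]
  obtain ⟨S, hS, hmin⟩ := WellFounded.has_min (wellFounded_lt (α := Set P))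
    {S | DefinitiveRootCause Fail S x} ⟨_, h0⟩
  exact ⟨S, hS, fun S' h' hd => hmin S' hd h'⟩

/-- If every minimal definitive root cause is a singleton and the
Disjointness Condition holds, Shortcut asserts exactly a minimal definitive root
cause (which is a singleton definitive root cause). -/
theorem shortcut_singleton_root_causes
    {P : Type*} [Fintype P] [DecidableEq P] {V : P → Type*}
    (Fail : ((p : P) → V p) → Prop)
    (f g : (p : P) → V p)
    (hf : Fail f) (hg : ¬ Fail g)
    (hdisj : ∀ p : P, f p ≠ g p)
    (hsing : ∀ (S : Set P) (c : (p : P) → V p),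
      MinimalDRC Fail S c → ∃ p : P, S = {p})
    (l : List P) (hnodup : l.Nodup) (hfull : ∀ p : P, p ∈ l) :
    MinimalDRC Fail (assertedSet (shortcutFinal Fail f g l) f) f ∧
      ∃ p : P, assertedSet (shortcutFinal Fail f g l) f = {p} ∧
        DefinitiveRootCause Fail ({p} : Set P) f := by
  obtain ⟨S, hS⟩ := aux_min Fail _ (aux_fail Fail g l f hf)
  obtain ⟨q, rfl⟩ := hsing _ _ hS
  set x := shortcutFinal Fail f g l with hx
  have hF : ∀ y : (p : P) → V p, y q = x q → Fail y := fun y hy =>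
    hS.1.2 y (by rintro p rfl; exact hy)
  have hne : x q ≠ g q := fun h => hg (hF g h.symm)
  have hxq : x q = f q := (aux_val Fail g l q f).resolve_right hne
  have hD : assertedSet x f = {q} := by
    ext r
    constructor
    · intro h
      by_contra hr
      have h1 := aux_other Fail g q r hr (x q) hne hF l f rfl (hfull r)
      exact hdisj r ((show x r = f r from h).symm.trans h1)
    · rintro rfl; exact hxq
  have hd : DefinitiveRootCause Fail ({q} : Set P) f :=
    ⟨⟨f, hf, fun _ _ => rfl⟩, fun y hy => hF y ((hy q rfl).trans hxq.symm)⟩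
  rw [hD]
  refine ⟨⟨hd, fun S' h' hd' => ?_⟩, q, rfl, hd⟩
  rw [Set.ssubset_singleton_iff] at h'
  subst h'
  exact hg (hd'.2 g (fun p hp => absurd hp (Set.notMem_empty p)))
end

section
/- Let f and g be pipeline instances with Fail f, not Fail g, and f and g disjoint (the Disjointness Condition). Then, for any list enumerating every parameter of P exactly once, the asserted root cause (D, f) of the Shortcut run on f and g never properly contains a minimal definitive root cause: there is no minimal definitive root cause (S, c) that is properly contained (as a set of parameter-value pairs) in (D, f). -/
open scoped Classical

theorem foldl_keep {P : Type*} [DecidableEq P] {V : P → Type*}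
    (Fail : ((p : P) → V p) → Prop) (g : (p : P) → V p) (q : P) (l : List P) :
    ∀ cur : (p : P) → V p, l.foldl (shortcutStep Fail g) cur q = cur q ∨
      l.foldl (shortcutStep Fail g) cur q = g q := by
  induction l with
  | nil => intro cur; left; rfl
  | cons a l ih =>
    intro cur
    have h : shortcutStep Fail g cur a q = cur q ∨ shortcutStep Fail g cur a q = g q := by
      unfold shortcutStep
      split_ifs
      · by_cases hq : q = a
        · subst hq; right; simp
        · left; simp [hq]
      · left; rfl
    rw [List.foldl_cons]
    rcases ih (shortcutStep Fail g cur a) with h1 | h1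
    · rw [h1]; exact h
    · right; exact h1

/-- Under the Disjointness Condition, the asserted root cause of
Shortcut never properly contains a minimal definitive root cause. -/
theorem shortcut_never_asserts_superset
    {P : Type*} [Fintype P] [DecidableEq P] {V : P → Type*}
    (Fail : ((p : P) → V p) → Prop)
    (f g : (p : P) → V p)
    (hf : Fail f) (hg : ¬ Fail g)
    (hdisj : ∀ p : P, f p ≠ g p)
    (l : List P) (hnodup : l.Nodup) (hfull : ∀ p : P, p ∈ l) :
    ¬ ∃ (S : Set P) (c : (p : P) → V p),
        MinimalDRC Fail S c ∧
        S ⊆ assertedSet (shortcutFinal Fail f g l) f ∧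
        (∀ p ∈ S, c p = f p) ∧
        S ≠ assertedSet (shortcutFinal Fail f g l) f := by
  rintro ⟨S, c, ⟨⟨-, hS⟩, -⟩, hsub, hc, hne⟩
  apply hne
  refine Set.Subset.antisymm hsub ?_
  intro p hp
  by_contra hpS
  obtain ⟨a, b, rfl⟩ := List.append_of_mem (hfull p)
  simp only [assertedSet, shortcutFinal, List.foldl_append, List.foldl_cons] at hp hsub
  have hF : Fail (Function.update (a.foldl (shortcutStep Fail g) f) p (g p)) := by
    apply hS
    intro q hq
    have hqp : q ≠ p := fun h => hpS (h ▸ hq)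
    rw [Function.update_of_ne hqp, hc q hq]
    rcases foldl_keep Fail g q a f with h | h
    · exact h
    · exfalso
      have h2 := hsub hq
      rw [Set.mem_setOf_eq] at h2
      rcases foldl_keep Fail g q (p :: b) (a.foldl (shortcutStep Fail g) f) with h3 | h3 <;>
        rw [List.foldl_cons, h2] at h3
      · exact hdisj q (h3.trans h)
      · exact hdisj q h3
  rw [Set.mem_setOf_eq] at hp
  have hs : shortcutStep Fail g (a.foldl (shortcutStep Fail g) f) p p = g p := by
    unfold shortcutStep at hF ⊢
    rw [if_pos hF]; simp
  rcases foldl_keep Fail g p b (shortcutStep Fail g (a.foldl (shortcutStep Fail g) f) p)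
    with h3 | h3 <;> rw [hp] at h3
  · exact hdisj p (h3.trans hs)
  · exact hdisj p h3
end

section
/- Let f and g be pipeline instances with Fail f, not Fail g, and f and g disjoint (the Disjointness Condition). Suppose that every two distinct minimal definitive root causes are sufficiently different. Then, for any list enumerating every parameter of P exactly once, the asserted root cause (D, f) of the Shortcut run on f and g is not a truncated assertion. -/
open scoped Classical

theorem exists_minimalDRC_of_fail {P : Type*} [Fintype P] {V : P → Type*}
    (Fail : ((p : P) → V p) → Prop) (x : (p : P) → V p) (hx : Fail x) :
    ∃ T : Set P, MinimalDRC Fail T x := by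
  have huniv : DefinitiveRootCause Fail Set.univ x := by
    refine ⟨⟨x, hx, fun _ _ => rfl⟩, fun y hy => ?_⟩
    have : y = x := funext fun p => hy p (Set.mem_univ p)
    exact this ▸ hx
  obtain ⟨T, hT, hmin⟩ := (wellFounded_lt (α := Set P)).has_min
    {T | DefinitiveRootCause Fail T x} ⟨_, huniv⟩
  exact ⟨T, hT, fun S' hS' h => hmin S' h hS'⟩

/-- If all pairs of distinct minimal definitive root causes are
sufficiently different and the Disjointness Condition holds, Shortcut never
produces a truncated assertion. -/
theorem shortcut_sufficiently_different_no_truncation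
    {P : Type*} [Fintype P] [DecidableEq P] {V : P → Type*}
    (Fail : ((p : P) → V p) → Prop)
    (f g : (p : P) → V p)
    (hf : Fail f) (hg : ¬ Fail g)
    (hdisj : ∀ p : P, f p ≠ g p)
    (hsd : ∀ (S₁ : Set P) (c₁ : (p : P) → V p) (S₂ : Set P) (c₂ : (p : P) → V p),
      MinimalDRC Fail S₁ c₁ → MinimalDRC Fail S₂ c₂ →
      ¬ (S₁ = S₂ ∧ ∀ p ∈ S₁, c₁ p = c₂ p) →
      (S₁ ∩ S₂).Nontrivial ∧ ∀ p ∈ S₁ ∩ S₂, c₁ p ≠ c₂ p)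
    (l : List P) (hnodup : l.Nodup) (hfull : ∀ p : P, p ∈ l) :
    ¬ ∃ (S : Set P) (c : (p : P) → V p),
        MinimalDRC Fail S c ∧
        assertedSet (shortcutFinal Fail f g l) f ⊆ S ∧
        (∀ p ∈ assertedSet (shortcutFinal Fail f g l) f, f p = c p) ∧
        assertedSet (shortcutFinal Fail f g l) f ≠ S := by
  rintro ⟨S, c, hS, hDS, hDc, hne⟩
  obtain ⟨T, hT⟩ := exists_minimalDRC_of_fail Fail f hf
  have key : ∀ (l : List P) (cur : (p : P) → V p), Satisfies cur T f →
      Satisfies (l.foldl (shortcutStep Fail g) cur) T f := by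
    intro l
    induction l with
    | nil => intro cur h; exact h
    | cons p l ih =>
      intro cur h
      rw [List.foldl_cons]
      apply ih
      unfold shortcutStep
      split_ifs with hF
      · by_cases hp : p ∈ T
        · exfalso
          obtain ⟨T1, hT1⟩ := exists_minimalDRC_of_fail Fail _ hF
          obtain ⟨⟨a, ha, b, hb, hab⟩, hall⟩ := hsd _ _ _ _ hT1 hT (by
            rintro ⟨rfl, heq⟩
            have := heq p hp
            rw [Function.update_self] at this
            exact hdisj p this.symm)
          have hq : ∀ q ∈ T1 ∩ T, q = p := by
            intro q hq
            by_contra hqp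
            apply hall q hq
            rw [Function.update_of_ne hqp]
            exact h q hq.2
          exact hab ((hq a ha).trans (hq b hb).symm)
        · intro q hq
          have hqp : q ≠ p := fun e => hp (e ▸ hq)
          rw [Function.update_of_ne hqp]
          exact h q hq
      · exact h
  have hTD : T ⊆ assertedSet (shortcutFinal Fail f g l) f :=
    fun p hp => key l f (fun _ _ => rfl) p hp
  have hTS : T ⊂ S := lt_of_le_of_lt hTD (lt_of_le_of_ne hDS hne)
  refine hS.2 T hTS ⟨⟨f, hf, fun p hp => hDc p (hTD hp)⟩, fun x hx => ?_⟩
  exact hT.1.2 x fun p hp => (hx p hp).trans (hDc p (hTD hp)).symm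
end

section
/- Let f and g be pipeline instances with Fail f, not Fail g, and f and g disjoint (the Disjointness Condition). If, for some list enumerating every parameter of P exactly once, the asserted root cause (D, f) of the Shortcut run on f and g is a truncated assertion, then there exists a minimal definitive root cause (S, c) such that c p = f p or c p = g p for every p ∈ S, and c p ≠ f p for at least one p ∈ S (i.e., (S, c) is contained in the union of the parameter-value pairs of f and g but is not contained in f). -/
open scoped Classical

theorem foldl_inv {P : Type*} [DecidableEq P] {V : P → Type*}
    (Fail : ((p : P) → V p) → Prop) (f g : (p : P) → V p) (l : List P) :
    ∀ cur : (p : P) → V p, Fail cur → (∀ p, cur p = f p ∨ cur p = g p) →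
      Fail (l.foldl (shortcutStep Fail g) cur) ∧
      ∀ p, l.foldl (shortcutStep Fail g) cur p = f p ∨
        l.foldl (shortcutStep Fail g) cur p = g p := by
  induction l with
  | nil => intro cur h1 h2; exact ⟨h1, h2⟩
  | cons a l ih =>
    intro cur h1 h2
    rw [List.foldl_cons]
    apply ih
    · unfold shortcutStep
      split_ifs with h
      · exact h
      · exact h1
    · intro p
      unfold shortcutStep
      split_ifs with h
      · by_cases hp : p = a
        · subst hp; right; simp
        · rw [Function.update_of_ne hp]; exact h2 p
      · exact h2 p

/-- If Shortcut yields a truncated assertion, then some minimal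
definitive root cause is contained in the union of the parameter-value pairs of
`f` and `g` but not contained in `f`. -/
theorem shortcut_truncation_implies_union_property
    {P : Type*} [Fintype P] [DecidableEq P] {V : P → Type*}
    (Fail : ((p : P) → V p) → Prop)
    (f g : (p : P) → V p)
    (hf : Fail f) (hg : ¬ Fail g)
    (hdisj : ∀ p : P, f p ≠ g p)
    (l : List P) (hnodup : l.Nodup) (hfull : ∀ p : P, p ∈ l)
    (htrunc : ∃ (S : Set P) (c : (p : P) → V p),
        MinimalDRC Fail S c ∧
        assertedSet (shortcutFinal Fail f g l) f ⊆ S ∧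
        (∀ p ∈ assertedSet (shortcutFinal Fail f g l) f, f p = c p) ∧
        assertedSet (shortcutFinal Fail f g l) f ≠ S) :
    ∃ (S : Set P) (c : (p : P) → V p),
        MinimalDRC Fail S c ∧
        (∀ p ∈ S, c p = f p ∨ c p = g p) ∧
        (∃ p ∈ S, c p ≠ f p) := by
  obtain ⟨S₀, c₀, hmin, hsub, hag, hne⟩ := htrunc
  obtain ⟨hz, hzfg⟩ : Fail (shortcutFinal Fail f g l) ∧ ∀ p, shortcutFinal Fail f g l p = f p ∨
      shortcutFinal Fail f g l p = g p :=
    foldl_inv Fail f g l f hf (fun p => Or.inl rfl)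
  generalize shortcutFinal Fail f g l = z at *
  have huniv : DefinitiveRootCause Fail Set.univ z := by
    refine ⟨⟨z, hz, fun p _ => rfl⟩, fun x hx => ?_⟩
    have : x = z := funext fun p => hx p (Set.mem_univ p)
    rw [this]; exact hz
  obtain ⟨S, hS, hSmin⟩ := (wellFounded_lt (α := Set P)).has_min
    {S | DefinitiveRootCause Fail S z} ⟨Set.univ, huniv⟩
  refine ⟨S, z, ⟨hS, fun S' hlt h => hSmin S' h hlt⟩, fun p _ => hzfg p, ?_⟩
  by_contra hcon
  push Not at hcon
  have hSD : S ⊆ assertedSet z f := fun p hp => hcon p hp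
  have heq : ∀ p ∈ S, z p = c₀ p := fun p hp => (hcon p hp).trans (hag p (hSD hp))
  refine hmin.2 S (lt_of_le_of_lt hSD (lt_of_le_of_ne hsub hne)) ?_
  exact ⟨⟨z, hz, heq⟩, fun x hx => hS.2 x fun p hp => (hx p hp).trans (heq p hp).symm⟩
end

section
/- Let f and g be pipeline instances with Fail f. Then for any list enumerating every parameter of P exactly once, the asserted root cause (D, f) of the Shortcut run on f and g is satisfied by some failing instance, namely the final instance of the run; hence the asserted candidate meets condition (i) of a hypothetical root cause of failure. -/
open scoped Classical

/-- The asserted root cause `(D, f)` of a Shortcut run starting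
from a failing instance `f` is satisfied by a failing instance, namely the final
instance of the run: condition (i) of a hypothetical root cause holds. -/
theorem shortcut_asserted_cause_satisfied_by_failing_instance
    {P : Type*} [Fintype P] [DecidableEq P] {V : P → Type*}
    (Fail : ((p : P) → V p) → Prop)
    (f g : (p : P) → V p)
    (hf : Fail f)
    (l : List P) (hnodup : l.Nodup) (hfull : ∀ p : P, p ∈ l) :
    Fail (shortcutFinal Fail f g l) ∧
      Satisfies (shortcutFinal Fail f g l)
        (assertedSet (shortcutFinal Fail f g l) f) f ∧
      ∃ x, Fail x ∧ Satisfies x (assertedSet (shortcutFinal Fail f g l) f) f := by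
  have key : ∀ (l : List P) (c : (p : P) → V p), Fail c →
      Fail (l.foldl (shortcutStep Fail g) c) := by
    intro l
    induction l with
    | nil => intro c hc; exact hc
    | cons a t ih =>
      intro c hc
      rw [List.foldl_cons]
      apply ih
      unfold shortcutStep
      split_ifs with h
      · exact h
      · exact hc
  have h1 : Fail (shortcutFinal Fail f g l) := key l f hf
  have h2 : Satisfies (shortcutFinal Fail f g l)
      (assertedSet (shortcutFinal Fail f g l) f) f := fun p hp => hp
  exact ⟨h1, h2, _, h1, h2⟩
end
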